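/- arXiv:2101.01247 — 4 statements merged into one kernel-verified Lean document; each statement's English description precedes it below -/
import Mathlib

section
/- Let m, b, k be positive integers, let U_1, …, U_k ∈ ℝ^{m×b}, and let ε ≥ 0 satisfy ‖U_iᵀU_i − I‖₂ ≤ ε for all 1 ≤ i ≤ k and ‖U_{i−1}ᵀU_i‖₂ ≤ ε for all 2 ≤ i ≤ k. Let B ∈ ℝ^{kb×(k+1)b} be a block upper bidiagonal matrix with b×b blocks: for 1 ≤ i ≤ k its (i,i) block equals a matrix R_i, for 1 ≤ i ≤ k its (i,i+1) block equals a matrix L_{i+1}, and all other blocks are zero. Let U_{(k)} = [U_1, …, U_k] ∈ ℝ^{m×kb} be the horizontal concatenation of the blocks. Then |‖U_{(k)}B‖_F² − ‖B‖_F²| ≤ 2ε‖B‖_F²; equivalently, ‖U_{(k)}B‖_F² = (1+θ)‖B‖_F² for some real θ with |θ| ≤ 2ε. -/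
open Matrix

/-- The spectral norm (operator norm induced by the Euclidean vector norm) of a real matrix. -/
noncomputable def specNorm {α β : Type*} [Fintype α] [Fintype β] [DecidableEq α] [DecidableEq β]
    (M : Matrix α β ℝ) : ℝ :=
  ‖(Matrix.toEuclideanLin M).toContinuousLinearMap‖

/-- The squared Frobenius norm of a real matrix. -/
def frobSq {α β : Type*} [Fintype α] [Fintype β] (M : Matrix α β ℝ) : ℝ :=
  ∑ i, ∑ j, (M i j) ^ 2

/-- Cauchy-Schwarz for the bilinear form of a matrix, in terms of its spectral norm. -/
theorem abs_dotProduct_mulVec_le_specNorm {α β : Type*} [Fintype α] [Fintype β] [DecidableEq α]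
    [DecidableEq β] (M : Matrix α β ℝ) (y : α → ℝ) (z : β → ℝ) :
    |y ⬝ᵥ (M *ᵥ z)| ≤ specNorm M * (‖WithLp.toLp 2 y‖ * ‖WithLp.toLp 2 z‖) := by
  have h1 : y ⬝ᵥ (M *ᵥ z) = inner ℝ (WithLp.toLp 2 y)
      ((Matrix.toEuclideanLin M).toContinuousLinearMap (WithLp.toLp 2 z)) := by
    simp [EuclideanSpace.inner_eq_star_dotProduct, dotProduct_comm]
  rw [h1]
  calc _ ≤ ‖WithLp.toLp 2 y‖ *
        ‖(Matrix.toEuclideanLin M).toContinuousLinearMap (WithLp.toLp 2 z)‖ :=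
        abs_real_inner_le_norm _ _
    _ ≤ ‖WithLp.toLp 2 y‖ * (specNorm M * ‖WithLp.toLp 2 z‖) := by
        gcongr
        exact ContinuousLinearMap.le_opNorm _ _
    _ = _ := by ring

theorem norm_toLp_two_sq_eq_dotProduct {α : Type*} [Fintype α] (y : α → ℝ) :
    ‖WithLp.toLp 2 y‖ ^ 2 = y ⬝ᵥ y := by
  rw [EuclideanSpace.real_norm_sq_eq]
  simp only [dotProduct, sq]

/-- A sum of almost orthogonal vectors almost satisfies the Pythagorean identity. -/
theorem abs_dotProduct_sum_sub_sum_sq_le {ι α : Type*} [DecidableEq ι] [Fintype α]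
    (s : Finset ι) (u : ι → α → ℝ) (w : ι → ℝ) (ε : ℝ) (hε : 0 ≤ ε)
    (h : ∀ i ∈ s, ∀ j ∈ s, |u i ⬝ᵥ u j - if i = j then w i ^ 2 else 0| ≤ ε * (w i * w j)) :
    |(∑ i ∈ s, u i) ⬝ᵥ (∑ i ∈ s, u i) - ∑ i ∈ s, w i ^ 2| ≤ s.card * ε * ∑ i ∈ s, w i ^ 2 := by
  have h1 : (∑ i ∈ s, u i) ⬝ᵥ (∑ i ∈ s, u i) - ∑ i ∈ s, w i ^ 2
      = ∑ i ∈ s, ∑ j ∈ s, (u i ⬝ᵥ u j - if i = j then w i ^ 2 else 0) := by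
    simp only [Finset.sum_sub_distrib, sum_dotProduct, dotProduct_sum]
    congr 1
    · exact Finset.sum_comm
    · exact Finset.sum_congr rfl fun i hi => by rw [Finset.sum_ite_eq, if_pos hi]
  rw [h1]
  calc _ ≤ ∑ i ∈ s, ∑ j ∈ s, ε * (w i * w j) :=
        (Finset.abs_sum_le_sum_abs _ _).trans <| Finset.sum_le_sum fun i hi =>
          (Finset.abs_sum_le_sum_abs _ _).trans <| Finset.sum_le_sum fun j hj => h i hi j hj
    _ = ε * (∑ i ∈ s, w i) ^ 2 := by
        rw [sq, Finset.sum_mul_sum]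
        simp only [Finset.mul_sum]
    _ ≤ ε * (s.card * ∑ i ∈ s, w i ^ 2) := by
        gcongr
        exact sq_sum_le_card_mul_sum_sq
    _ = _ := by ring

/-- If `U₁, …, U_k ∈ ℝ^{m×b}` have local loss of orthogonality at most `ε`
(each `‖Uᵢᵀ Uᵢ - I‖₂ ≤ ε` and adjacent blocks satisfy `‖Uᵢ₋₁ᵀ Uᵢ‖₂ ≤ ε`), and
`B ∈ ℝ^{kb×(k+1)b}` is block upper bidiagonal with `b×b` blocks `Rᵢ` on the diagonal
and `Lᵢ₊₁` on the superdiagonal, then with `U₍k₎ = [U₁, …, U_k]` one has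
`‖U₍k₎ B‖_F² = (1+θ)‖B‖_F²` with `|θ| ≤ 2ε`.
Here block rows are indexed by `Fin k × Fin b` and block columns by `Fin (k+1) × Fin b`;
`U i` denotes `U_{i+1}`, `R i` denotes `R_{i+1}` and `L i` denotes `L_{i+2}` (0-based indexing). -/

theorem blockBidiag_frobSq_mul_left (m b k : ℕ) (hm : 0 < m) (hb : 0 < b) (hk : 0 < k)
    (U : Fin k → Matrix (Fin m) (Fin b) ℝ)
    (R : Fin k → Matrix (Fin b) (Fin b) ℝ)
    (L : Fin k → Matrix (Fin b) (Fin b) ℝ)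
    (ε : ℝ) (hε : 0 ≤ ε)
    (hUdiag : ∀ i : Fin k, specNorm ((U i)ᵀ * U i - 1) ≤ ε)
    (hUadj : ∀ i j : Fin k, (j : ℕ) = (i : ℕ) + 1 → specNorm ((U i)ᵀ * U j) ≤ ε)
    (B : Matrix (Fin k × Fin b) (Fin (k + 1) × Fin b) ℝ)
    (hB : ∀ (i : Fin k) (j : Fin (k + 1)) (r c : Fin b),
      B (i, r) (j, c) =
        if (j : ℕ) = (i : ℕ) then R i r c
        else if (j : ℕ) = (i : ℕ) + 1 then L i r c
        else 0)
    (Ucat : Matrix (Fin m) (Fin k × Fin b) ℝ)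
    (hUcat : ∀ (r : Fin m) (p : Fin k × Fin b), Ucat r p = U p.1 r p.2) :
    ∃ θ : ℝ, |θ| ≤ 2 * ε ∧ frobSq (Ucat * B) = (1 + θ) * frobSq B := by
  have hcol : ∀ q : Fin (k + 1) × Fin b,
      |∑ r, (Ucat * B) r q ^ 2 - ∑ p, B p q ^ 2| ≤ 2 * ε * ∑ p, B p q ^ 2 := by
    rintro ⟨j, c⟩
    set x : Fin k → Fin b → ℝ := fun i r => B (i, r) (j, c) with hx
    set s : Finset (Fin k) :=
      Finset.univ.filter fun i => (j : ℕ) = (i : ℕ) ∨ (j : ℕ) = (i : ℕ) + 1 with hs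
    have hxs : ∀ i, i ∉ s → x i = 0 := by
      intro i hi
      simp only [hs, Finset.mem_filter, Finset.mem_univ, true_and, not_or] at hi
      ext r
      simp [hx, hB, hi.1, hi.2]
    have hcard : s.card ≤ 2 := by
      rw [← Finset.card_map Fin.valEmbedding]
      refine (Finset.card_le_card (t := {(j : ℕ), (j : ℕ) - 1}) ?_).trans Finset.card_le_two
      intro a ha
      simp only [hs, Finset.mem_map, Finset.mem_filter, Finset.mem_univ, true_and,
        Fin.valEmbedding_apply] at ha
      obtain ⟨i, hi, rfl⟩ := ha
      simp only [Finset.mem_insert, Finset.mem_singleton]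
      omega
    have hadj : ∀ i i' : Fin k, (i' : ℕ) = (i : ℕ) + 1 →
        |(U i *ᵥ x i) ⬝ᵥ (U i' *ᵥ x i')| ≤
          ε * (‖WithLp.toLp 2 (x i)‖ * ‖WithLp.toLp 2 (x i')‖) := by
      intro i i' hii
      have h2 : (U i *ᵥ x i) ⬝ᵥ (U i' *ᵥ x i') = x i ⬝ᵥ (((U i)ᵀ * U i') *ᵥ x i') := by
        rw [← mulVec_mulVec, dotProduct_mulVec (x i), vecMul_transpose]
      rw [h2]
      exact (abs_dotProduct_mulVec_le_specNorm _ _ _).trans (by gcongr; exact hUadj i i' hii)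
    have key := abs_dotProduct_sum_sub_sum_sq_le s (fun i => U i *ᵥ x i)
      (fun i => ‖WithLp.toLp 2 (x i)‖) ε hε (by
        intro i hi i' hi'
        simp only [hs, Finset.mem_filter, Finset.mem_univ, true_and] at hi hi'
        by_cases h : i = i'
        · subst h
          have h2 : (U i *ᵥ x i) ⬝ᵥ (U i *ᵥ x i) - x i ⬝ᵥ x i
              = x i ⬝ᵥ (((U i)ᵀ * U i - 1) *ᵥ x i) := by
            rw [sub_mulVec, one_mulVec, dotProduct_sub, ← mulVec_mulVec,
              dotProduct_mulVec (x i) (U i)ᵀ, vecMul_transpose]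
          rw [if_pos rfl, norm_toLp_two_sq_eq_dotProduct, h2]
          exact (abs_dotProduct_mulVec_le_specNorm _ _ _).trans (by gcongr; exact hUdiag i)
        · rw [if_neg h, sub_zero]
          have h' : (i : ℕ) ≠ i' := fun e => h (Fin.ext e)
          rcases (by omega : (i' : ℕ) = i + 1 ∨ (i : ℕ) = i' + 1) with h3 | h3
          · exact hadj i i' h3
          · rw [dotProduct_comm, mul_comm ‖WithLp.toLp 2 (x i)‖]
            exact hadj i' i h3)
    have hU : ∑ i ∈ s, U i *ᵥ x i = fun r => (Ucat * B) r (j, c) := by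
      rw [Finset.sum_subset (Finset.subset_univ s) fun i _ hi => by rw [hxs i hi, mulVec_zero]]
      ext r
      simp [Matrix.mul_apply, Fintype.sum_prod_type, hUcat, mulVec, dotProduct, hx]
    have hN : ∑ i ∈ s, ‖WithLp.toLp 2 (x i)‖ ^ 2 = ∑ p, B p (j, c) ^ 2 := by
      rw [Finset.sum_subset (Finset.subset_univ s) fun i _ hi => by simp [hxs i hi]]
      simp [Fintype.sum_prod_type, EuclideanSpace.real_norm_sq_eq, hx]
    rw [hN, hU] at key
    have hd : (fun r => (Ucat * B) r (j, c)) ⬝ᵥ (fun r => (Ucat * B) r (j, c))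
        = ∑ r, (Ucat * B) r (j, c) ^ 2 := by
      simp only [dotProduct, sq]
    rw [hd] at key
    refine key.trans ?_
    gcongr
    exact_mod_cast hcard
  have hmain : |frobSq (Ucat * B) - frobSq B| ≤ 2 * ε * frobSq B := by
    unfold frobSq
    rw [Finset.sum_comm, Finset.sum_comm (f := fun i j => B i j ^ 2), ← Finset.sum_sub_distrib,
      Finset.mul_sum]
    exact (Finset.abs_sum_le_sum_abs _ _).trans (Finset.sum_le_sum fun q _ => hcol q)
  have hB0 : 0 ≤ frobSq B := Finset.sum_nonneg fun _ _ => Finset.sum_nonneg fun _ _ => sq_nonneg _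
  rcases hB0.eq_or_lt with h0 | h0
  · refine ⟨0, by simpa using hε, ?_⟩
    rw [← h0] at hmain ⊢
    simpa using hmain
  · refine ⟨(frobSq (Ucat * B) - frobSq B) / frobSq B, ?_, ?_⟩
    · rwa [abs_div, abs_of_pos h0, div_le_iff₀ h0]
    · field_simp
      ring
end

section
/- Let m, b, c be positive integers, let U_1, U_2 ∈ ℝ^{m×b}, let L, R ∈ ℝ^{b×c}, and let ε ≥ 0 satisfy ‖U_1ᵀU_1 − I‖₂ ≤ ε, ‖U_2ᵀU_2 − I‖₂ ≤ ε, and ‖U_2ᵀU_1‖₂ ≤ ε. Then |‖U_1L + U_2R‖_F² − (‖L‖_F² + ‖R‖_F²)| ≤ 2ε(‖L‖_F² + ‖R‖_F²); equivalently, ‖U_1L + U_2R‖_F² = (1+θ)(‖L‖_F² + ‖R‖_F²) for some real θ with |θ| ≤ 2ε. -/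
open Matrix

theorem dotProduct_self_eq_norm_toLp_sq {ι : Type*} [Fintype ι] (v : ι → ℝ) :
    v ⬝ᵥ v = ‖WithLp.toLp 2 v‖ ^ 2 := by
  rw [EuclideanSpace.real_norm_sq_eq]
  simp [dotProduct, sq]

/-- The bilinear form of `M` is bounded by `specNorm M` times the mean of the squared lengths. -/
theorem abs_dotProduct_mulVec_le {α β : Type*} [Fintype α] [Fintype β] [DecidableEq α]
    [DecidableEq β] {M : Matrix α β ℝ} {ε : ℝ} (hM : specNorm M ≤ ε) (y : α → ℝ) (x : β → ℝ) :
    |y ⬝ᵥ (M *ᵥ x)| ≤ ε * ((y ⬝ᵥ y + x ⬝ᵥ x) / 2) := by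
  have hε : 0 ≤ ε := (norm_nonneg _).trans hM
  have hinner : y ⬝ᵥ (M *ᵥ x) =
      inner ℝ (WithLp.toLp 2 y) ((Matrix.toEuclideanLin M).toContinuousLinearMap
        (WithLp.toLp 2 x)) := by
    simp [EuclideanSpace.inner_eq_star_dotProduct, dotProduct_comm, Matrix.toLpLin_apply]
  have hop := (Matrix.toEuclideanLin M).toContinuousLinearMap.le_of_opNorm_le hM
    (WithLp.toLp 2 x)
  rw [hinner, dotProduct_self_eq_norm_toLp_sq y, dotProduct_self_eq_norm_toLp_sq x]
  calc _ ≤ _ := abs_real_inner_le_norm _ _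
    _ ≤ ‖WithLp.toLp 2 y‖ * (ε * ‖WithLp.toLp 2 x‖) := by gcongr
    _ = ε * (‖WithLp.toLp 2 y‖ * ‖WithLp.toLp 2 x‖) := by ring
    _ ≤ _ := by
      gcongr
      linarith [two_mul_le_add_sq ‖WithLp.toLp 2 y‖ ‖WithLp.toLp 2 x‖]

theorem frobSq_eq_sum_col {α β : Type*} [Fintype α] [Fintype β] (M : Matrix α β ℝ) :
    frobSq M = ∑ j, M.col j ⬝ᵥ M.col j := by
  rw [frobSq, Finset.sum_comm]
  simp [dotProduct, sq]

/-- Near-orthonormality of the columns of `U₁` and `U₂` jointly, on a pair of vectors. -/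
theorem abs_dotProduct_self_add_sub_le {α β : Type*} [Fintype α] [Fintype β] [DecidableEq β]
    {U₁ U₂ : Matrix α β ℝ} {ε : ℝ} (hU₁ : specNorm (U₁ᵀ * U₁ - 1) ≤ ε)
    (hU₂ : specNorm (U₂ᵀ * U₂ - 1) ≤ ε) (hU₁₂ : specNorm (U₂ᵀ * U₁) ≤ ε) (x y : β → ℝ) :
    |(U₁ *ᵥ x + U₂ *ᵥ y) ⬝ᵥ (U₁ *ᵥ x + U₂ *ᵥ y) - (x ⬝ᵥ x + y ⬝ᵥ y)| ≤
      2 * ε * (x ⬝ᵥ x + y ⬝ᵥ y) := by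
  have hgram (A B : Matrix α β ℝ) (u v : β → ℝ) :
      u ⬝ᵥ ((Aᵀ * B) *ᵥ v) = (A *ᵥ u) ⬝ᵥ (B *ᵥ v) := by
    rw [← mulVec_mulVec, dotProduct_mulVec, vecMul_transpose]
  have h₁ := abs_le.1 (abs_dotProduct_mulVec_le hU₁ x x)
  have h₂ := abs_le.1 (abs_dotProduct_mulVec_le hU₂ y y)
  have h₁₂ := abs_le.1 (abs_dotProduct_mulVec_le hU₁₂ y x)
  simp only [sub_mulVec, one_mulVec, dotProduct_sub, hgram] at h₁ h₂ h₁₂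
  simp only [add_dotProduct, dotProduct_add, dotProduct_comm (U₁ *ᵥ x) (U₂ *ᵥ y)]
  rw [abs_le]
  constructor <;> linarith [h₁.1, h₁.2, h₂.1, h₂.2, h₁₂.1, h₁₂.2]

/-- If `U₁, U₂ ∈ ℝ^{m×b}` satisfy `‖U₁ᵀU₁ - I‖₂ ≤ ε`, `‖U₂ᵀU₂ - I‖₂ ≤ ε`,
`‖U₂ᵀU₁‖₂ ≤ ε`, and `L, R ∈ ℝ^{b×c}`, then
`‖U₁L + U₂R‖_F² = (1+θ)(‖L‖_F² + ‖R‖_F²)` for some `θ` with `|θ| ≤ 2ε`. -/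
theorem frobSq_add_two_blocks (m b c : ℕ) (hm : 0 < m) (hb : 0 < b) (hc : 0 < c)
    (U₁ U₂ : Matrix (Fin m) (Fin b) ℝ)
    (L R : Matrix (Fin b) (Fin c) ℝ)
    (ε : ℝ) (hε : 0 ≤ ε)
    (hU₁ : specNorm (U₁ᵀ * U₁ - 1) ≤ ε)
    (hU₂ : specNorm (U₂ᵀ * U₂ - 1) ≤ ε)
    (hU₁₂ : specNorm (U₂ᵀ * U₁) ≤ ε) :
    ∃ θ : ℝ, |θ| ≤ 2 * ε ∧ frobSq (U₁ * L + U₂ * R) = (1 + θ) * (frobSq L + frobSq R) := by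
  have hbound : |frobSq (U₁ * L + U₂ * R) - (frobSq L + frobSq R)| ≤
      2 * ε * (frobSq L + frobSq R) := by
    simp only [frobSq_eq_sum_col, ← Finset.sum_add_distrib, ← Finset.sum_sub_distrib,
      Finset.mul_sum]
    refine (Finset.abs_sum_le_sum_abs _ _).trans (Finset.sum_le_sum fun j _ => ?_)
    exact abs_dotProduct_self_add_sub_le hU₁ hU₂ hU₁₂ (L.col j) (R.col j)
  have hnonneg : 0 ≤ frobSq L + frobSq R := by
    unfold frobSq
    positivity
  rcases hnonneg.eq_or_lt with h | h
  · refine ⟨0, by simpa using hε, ?_⟩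
    rw [← h] at hbound ⊢
    simpa using hbound
  · refine ⟨(frobSq (U₁ * L + U₂ * R) - (frobSq L + frobSq R)) / (frobSq L + frobSq R), ?_, ?_⟩
    · rwa [abs_div, abs_of_pos h, div_le_iff₀ h]
    · field_simp
      ring
end

section
/- Let A ∈ ℝ^{m×n}, U ∈ ℝ^{m×s}, B ∈ ℝ^{s×t}, and V ∈ ℝ^{n×t} be real matrices satisfying UᵀU = I, VᵀV = I, and AᵀU = V Bᵀ. Then ‖A − U B Vᵀ‖_F² = ‖A‖_F² − ‖B‖_F². -/
open Matrix

/-- The squared Frobenius norm of `M` is the trace of the Gram matrix `MᵀM`. -/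
theorem frobSq_eq_trace {α β : Type*} [Fintype α] [Fintype β] (M : Matrix α β ℝ) :
    frobSq M = (Mᵀ * M).trace := by
  simp only [frobSq, Matrix.trace, Matrix.diag, Matrix.mul_apply, Matrix.transpose_apply, ← sq]
  exact Finset.sum_comm

/-- If `UᵀU = I`, `VᵀV = I` and `AᵀU = V Bᵀ` (the exact-arithmetic block
Lanczos relation), then `‖A − U B Vᵀ‖_F² = ‖A‖_F² − ‖B‖_F²`. -/
theorem frobSq_sub_UBVt_of_lanczos (m n s t : ℕ)
    (A : Matrix (Fin m) (Fin n) ℝ)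
    (U : Matrix (Fin m) (Fin s) ℝ)
    (B : Matrix (Fin s) (Fin t) ℝ)
    (V : Matrix (Fin n) (Fin t) ℝ)
    (hU : Uᵀ * U = 1)
    (hV : Vᵀ * V = 1)
    (hAU : Aᵀ * U = V * Bᵀ) :
    frobSq (A - U * B * Vᵀ) = frobSq A - frobSq B := by
  have hUA : Uᵀ * A = B * Vᵀ := by
    simpa using congrArg Matrix.transpose hAU
  have hgram : (A - U * B * Vᵀ)ᵀ * (A - U * B * Vᵀ) = Aᵀ * A - V * (Bᵀ * B * Vᵀ) := by
    have h₁ : Aᵀ * (U * B * Vᵀ) = V * (Bᵀ * B * Vᵀ) := by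
      simp only [← Matrix.mul_assoc, hAU]
    have h₂ : (U * B * Vᵀ)ᵀ * A = V * (Bᵀ * B * Vᵀ) := by
      simp only [Matrix.transpose_mul, Matrix.transpose_transpose, Matrix.mul_assoc, hUA]
    have h₃ : (U * B * Vᵀ)ᵀ * (U * B * Vᵀ) = V * (Bᵀ * B * Vᵀ) := by
      simp only [Matrix.transpose_mul, Matrix.transpose_transpose, Matrix.mul_assoc]
      rw [← Matrix.mul_assoc Uᵀ, hU, Matrix.one_mul]
    rw [Matrix.transpose_sub, Matrix.sub_mul, Matrix.mul_sub, Matrix.mul_sub, h₁, h₂, h₃]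
    abel
  rw [frobSq_eq_trace, frobSq_eq_trace, frobSq_eq_trace, hgram, Matrix.trace_sub,
    Matrix.trace_mul_comm V, Matrix.mul_assoc, hV, Matrix.mul_one]
end

section
/- Let A ∈ ℝ^{m×n}, let b, k be positive integers, and let V_1, …, V_{k+1} ∈ ℝ^{n×b}, U_1, …, U_k ∈ ℝ^{m×b}, R_1, …, R_k ∈ ℝ^{b×b}, L_1, …, L_{k+1} ∈ ℝ^{b×b} satisfy the block Lanczos bidiagonalization recurrences: with U_0 = 0 and L_1 = 0, for every 1 ≤ i ≤ k one has A V_i = U_i R_i + U_{i−1} L_i and Aᵀ U_i = V_{i+1} L_{i+1}ᵀ + V_i R_iᵀ. Assume moreover that R_i is invertible for every 1 ≤ i ≤ k and L_{i+1} is invertible for every 1 ≤ i ≤ k. Then the span of the columns of U_1, …, U_k equals the span of the columns of the matrices A V_1, A(AᵀA)V_1, …, A(AᵀA)^{k−1}V_1, and the span of the columns of V_1, …, V_{k+1} equals the span of the columns of the matrices V_1, (AᵀA)V_1, …, (AᵀA)^{k}V_1. -/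
open Matrix

/-- The span of the columns of a matrix. -/
def colSpan {p q : ℕ} (X : Matrix (Fin p) (Fin q) ℝ) : Submodule ℝ (Fin p → ℝ) :=
  Submodule.span ℝ (Set.range fun c : Fin q => Xᵀ c)

theorem colSpan_eq_range {p q : ℕ} (X : Matrix (Fin p) (Fin q) ℝ) :
    colSpan X = LinearMap.range X.mulVecLin :=
  (Matrix.range_mulVecLin X).symm

theorem colSpan_mul {p q r : ℕ} (A : Matrix (Fin p) (Fin q) ℝ) (X : Matrix (Fin q) (Fin r) ℝ) :
    colSpan (A * X) = (colSpan X).map A.mulVecLin := by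
  rw [colSpan_eq_range, colSpan_eq_range, Matrix.mulVecLin_mul, LinearMap.range_comp]

theorem colSpan_mul_le {p q r : ℕ} (X : Matrix (Fin p) (Fin q) ℝ) (M : Matrix (Fin q) (Fin r) ℝ) :
    colSpan (X * M) ≤ colSpan X := by
  rw [colSpan_eq_range, colSpan_eq_range, Matrix.mulVecLin_mul]
  exact LinearMap.range_comp_le_range _ _

theorem colSpan_zero {p q : ℕ} : colSpan (0 : Matrix (Fin p) (Fin q) ℝ) = ⊥ := by
  rw [colSpan_eq_range, Matrix.mulVecLin_zero, LinearMap.range_zero]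

theorem colSpan_mul_of_isUnit {p q : ℕ} (X : Matrix (Fin p) (Fin q) ℝ)
    {M : Matrix (Fin q) (Fin q) ℝ} (hM : IsUnit M) : colSpan (X * M) = colSpan X := by
  obtain ⟨u, rfl⟩ := hM
  refine le_antisymm (colSpan_mul_le _ _) ?_
  simpa [Matrix.mul_assoc] using
    colSpan_mul_le (X * (u : Matrix (Fin q) (Fin q) ℝ)) (↑u⁻¹ : Matrix (Fin q) (Fin q) ℝ)

theorem sup_colSpan_add_le {p q : ℕ} {S : Submodule ℝ (Fin p → ℝ)}
    (Y : Matrix (Fin p) (Fin q) ℝ) {Z : Matrix (Fin p) (Fin q) ℝ} (hZ : colSpan Z ≤ S) :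
    S ⊔ colSpan (Y + Z) ≤ S ⊔ colSpan Y := by
  refine sup_le le_sup_left (Submodule.span_le.2 ?_)
  rintro _ ⟨c, rfl⟩
  have hY : Yᵀ c ∈ colSpan Y := Submodule.subset_span ⟨c, rfl⟩
  have hZ' : Zᵀ c ∈ colSpan Z := Submodule.subset_span ⟨c, rfl⟩
  exact add_mem (Submodule.mem_sup_right hY) (Submodule.mem_sup_left (hZ hZ'))

theorem colSpan_neg {p q : ℕ} (X : Matrix (Fin p) (Fin q) ℝ) : colSpan (-X) = colSpan X := by
  have h (Y : Matrix (Fin p) (Fin q) ℝ) : colSpan (-Y) ≤ colSpan Y := by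
    simpa using colSpan_mul_le Y (-1 : Matrix (Fin q) (Fin q) ℝ)
  exact le_antisymm (h X) (by simpa using h (-X))

theorem sup_colSpan_add {p q : ℕ} {S : Submodule ℝ (Fin p → ℝ)}
    (Y : Matrix (Fin p) (Fin q) ℝ) {Z : Matrix (Fin p) (Fin q) ℝ} (hZ : colSpan Z ≤ S) :
    S ⊔ colSpan (Y + Z) = S ⊔ colSpan Y := by
  refine le_antisymm (sup_colSpan_add_le Y hZ) ?_
  simpa using sup_colSpan_add_le (Y + Z) ((colSpan_neg Z).trans_le hZ)

/-- The span of the columns of a finite family of matrices. -/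
def familySpan {p q : ℕ} (s : Finset ℕ) (X : ℕ → Matrix (Fin p) (Fin q) ℝ) :
    Submodule ℝ (Fin p → ℝ) :=
  ⨆ i ∈ s, colSpan (X i)

theorem span_iUnion_columns {p q : ℕ} (s : Finset ℕ) (X : ℕ → Matrix (Fin p) (Fin q) ℝ) :
    Submodule.span ℝ (⋃ i ∈ s, Set.range fun c : Fin q => (X i)ᵀ c) = familySpan s X :=
  Submodule.span_iUnion₂ _

theorem colSpan_le_familySpan {p q : ℕ} {s : Finset ℕ} {i : ℕ} (hi : i ∈ s)
    (X : ℕ → Matrix (Fin p) (Fin q) ℝ) : colSpan (X i) ≤ familySpan s X :=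
  le_iSup₂_of_le i hi le_rfl

theorem familySpan_Icc_succ {p q : ℕ} (j : ℕ) (X : ℕ → Matrix (Fin p) (Fin q) ℝ) :
    familySpan (Finset.Icc 1 (j + 1)) X = familySpan (Finset.Icc 1 j) X ⊔ colSpan (X (j + 1)) := by
  have h : Finset.Icc 1 (j + 1) = insert (j + 1) (Finset.Icc 1 j) := by
    ext i
    simp only [Finset.mem_Icc, Finset.mem_insert]
    lia
  rw [familySpan, h, Finset.iSup_insert, sup_comm, familySpan]

theorem familySpan_range_succ {p q : ℕ} (j : ℕ) (X : ℕ → Matrix (Fin p) (Fin q) ℝ) :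
    familySpan (Finset.range (j + 1)) X = familySpan (Finset.range j) X ⊔ colSpan (X j) := by
  rw [familySpan, Finset.range_add_one, Finset.iSup_insert, sup_comm, familySpan]

theorem familySpan_mul {p q r : ℕ} (s : Finset ℕ) (A : Matrix (Fin p) (Fin q) ℝ)
    (X : ℕ → Matrix (Fin q) (Fin r) ℝ) :
    familySpan s (fun i => A * X i) = (familySpan s X).map A.mulVecLin := by
  simp only [familySpan, Submodule.map_iSup, colSpan_mul]

theorem familySpan_pow_succ {p q : ℕ} (G : Matrix (Fin p) (Fin p) ℝ)
    (X : Matrix (Fin p) (Fin q) ℝ) (j : ℕ) :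
    familySpan (Finset.range (j + 1)) (fun i => G ^ i * X) =
      colSpan X ⊔ (familySpan (Finset.range j) fun i => G ^ i * X).map G.mulVecLin := by
  induction j with
  | zero => simp [familySpan]
  | succ j ih =>
    rw [familySpan_range_succ j, Submodule.map_sup, ← colSpan_mul, ← Matrix.mul_assoc,
      ← pow_succ', ← sup_assoc, ← ih, familySpan_range_succ (j + 1)]

theorem familySpan_left_eq_map {m n b k : ℕ} {A : Matrix (Fin m) (Fin n) ℝ}
    {V : ℕ → Matrix (Fin n) (Fin b) ℝ} {U : ℕ → Matrix (Fin m) (Fin b) ℝ}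
    {R L : ℕ → Matrix (Fin b) (Fin b) ℝ} (hU0 : U 0 = 0)
    (hrec : ∀ i, 1 ≤ i → i ≤ k → A * V i = U i * R i + U (i - 1) * L i)
    (hR : ∀ i, 1 ≤ i → i ≤ k → IsUnit (R i)) {j : ℕ} (hj : j ≤ k) :
    familySpan (Finset.Icc 1 j) U = (familySpan (Finset.Icc 1 j) V).map A.mulVecLin := by
  induction j with
  | zero => simp [familySpan]
  | succ j ih =>
    have hprev : colSpan (U j * L (j + 1)) ≤ familySpan (Finset.Icc 1 j) U := by
      rcases Nat.eq_zero_or_pos j with rfl | hpos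
      · simp [hU0, colSpan_zero]
      · exact (colSpan_mul_le _ _).trans
          (colSpan_le_familySpan (Finset.mem_Icc.2 ⟨hpos, le_rfl⟩) U)
    rw [familySpan_Icc_succ, familySpan_Icc_succ, Submodule.map_sup, ← ih (by lia), ← colSpan_mul,
      hrec (j + 1) (by lia) hj, Nat.add_sub_cancel, sup_colSpan_add _ hprev,
      colSpan_mul_of_isUnit _ (hR (j + 1) (by lia) hj)]

theorem familySpan_right_eq_sup_map {m n b k : ℕ} {A : Matrix (Fin m) (Fin n) ℝ}
    {V : ℕ → Matrix (Fin n) (Fin b) ℝ} {U : ℕ → Matrix (Fin m) (Fin b) ℝ}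
    {R L : ℕ → Matrix (Fin b) (Fin b) ℝ}
    (hrec : ∀ i, 1 ≤ i → i ≤ k → Aᵀ * U i = V (i + 1) * (L (i + 1))ᵀ + V i * (R i)ᵀ)
    (hL : ∀ i, 1 ≤ i → i ≤ k → IsUnit (L (i + 1))) {j : ℕ} (hj : j ≤ k) :
    familySpan (Finset.Icc 1 (j + 1)) V =
      colSpan (V 1) ⊔ (familySpan (Finset.Icc 1 j) U).map Aᵀ.mulVecLin := by
  induction j with
  | zero => simp [familySpan]
  | succ j ih =>
    have hprev : colSpan (V (j + 1) * (R (j + 1))ᵀ) ≤ familySpan (Finset.Icc 1 (j + 1)) V :=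
      (colSpan_mul_le _ _).trans
        (colSpan_le_familySpan (Finset.mem_Icc.2 ⟨by lia, le_rfl⟩) V)
    rw [familySpan_Icc_succ (j + 1), familySpan_Icc_succ j U, Submodule.map_sup, ← sup_assoc,
      ← ih (by lia), ← colSpan_mul, hrec (j + 1) (by lia) hj, sup_colSpan_add _ hprev,
      colSpan_mul_of_isUnit _ ((Matrix.isUnit_transpose _).2 (hL (j + 1) (by lia) hj))]

/-- the Krylov-space property of block Lanczos bidiagonalization.
Families are indexed by natural numbers: the relevant blocks are `V 1, …, V (k+1)`,
`U 1, …, U k` (with `U 0 = 0`), `R 1, …, R k`, and `L 1, …, L (k+1)` (with `L 1 = 0`).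
Assuming the recurrences hold and all `R i` (`1 ≤ i ≤ k`) and `L (i+1)` (`1 ≤ i ≤ k`)
are invertible, the span of the columns of `U_1, …, U_k` equals the span of the columns of
`A V_1, A(AᵀA)V_1, …, A(AᵀA)^{k−1} V_1`, and the span of the columns of `V_1, …, V_{k+1}`
equals the span of the columns of `V_1, (AᵀA)V_1, …, (AᵀA)^k V_1`. -/
theorem blockLanczos_krylov_span (m n b k : ℕ) (hb : 0 < b) (hk : 0 < k)
    (A : Matrix (Fin m) (Fin n) ℝ)
    (V : ℕ → Matrix (Fin n) (Fin b) ℝ)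
    (U : ℕ → Matrix (Fin m) (Fin b) ℝ)
    (R : ℕ → Matrix (Fin b) (Fin b) ℝ)
    (L : ℕ → Matrix (Fin b) (Fin b) ℝ)
    (hU0 : U 0 = 0) (hL1 : L 1 = 0)
    (hrec1 : ∀ i, 1 ≤ i → i ≤ k → A * V i = U i * R i + U (i - 1) * L i)
    (hrec2 : ∀ i, 1 ≤ i → i ≤ k → Aᵀ * U i = V (i + 1) * (L (i + 1))ᵀ + V i * (R i)ᵀ)
    (hRinv : ∀ i, 1 ≤ i → i ≤ k → IsUnit (R i))
    (hLinv : ∀ i, 1 ≤ i → i ≤ k → IsUnit (L (i + 1))) :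
    (Submodule.span ℝ (⋃ i ∈ Finset.Icc 1 k, Set.range fun c : Fin b => (U i)ᵀ c) =
      Submodule.span ℝ
        (⋃ j ∈ Finset.range k, Set.range fun c : Fin b => (A * (Aᵀ * A) ^ j * V 1)ᵀ c)) ∧
    (Submodule.span ℝ (⋃ i ∈ Finset.Icc 1 (k + 1), Set.range fun c : Fin b => (V i)ᵀ c) =
      Submodule.span ℝ
        (⋃ j ∈ Finset.range (k + 1), Set.range fun c : Fin b => ((Aᵀ * A) ^ j * V 1)ᵀ c)) := by
  have hV : ∀ j ≤ k + 1, familySpan (Finset.Icc 1 j) V =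
      familySpan (Finset.range j) fun i => (Aᵀ * A) ^ i * V 1 := by
    intro j
    induction j with
    | zero => simp [familySpan]
    | succ j ih =>
      intro hj
      rw [familySpan_right_eq_sup_map hrec2 hLinv (by lia),
        familySpan_left_eq_map hU0 hrec1 hRinv (by lia), ih (by lia), familySpan_pow_succ,
        Matrix.mulVecLin_mul, Submodule.map_comp]
  constructor
  · rw [span_iUnion_columns, span_iUnion_columns, familySpan_left_eq_map hU0 hrec1 hRinv le_rfl,
      hV k (by lia), ← familySpan_mul]
    simp only [Matrix.mul_assoc]
  · rw [span_iUnion_columns, span_iUnion_columns, hV (k + 1) le_rfl]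
end
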